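/- arXiv:1811.08402 — 2 statements merged into one kernel-verified Lean document; each statement's English description precedes it below -/
import Mathlib

section
/- Let R be a Noetherian ring and E a finitely generated R-module. Then E has a rank e (i.e., E ⊗_R Quot(R) is free of rank e over the total quotient ring) if and only if E_p is a free R_p-module of rank e for every associated prime p of R. -/
open scoped TensorProduct

noncomputable section

universe u

section Defs
variable (R : Type u) [CommRing R]

/-- The total ring of fractions of `R`. -/
abbrev TotalQuot := Localization (nonZeroDivisors R)

/-- `E` has rank `e`: `E ⊗_R Quot(R)` is free of rank `e` over the total quotient ring. -/
def HasRank (E : Type u) [AddCommGroup E] [Module R E] (e : ℕ) : Prop :=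
  Nonempty ((TotalQuot R ⊗[R] E) ≃ₗ[TotalQuot R] (Fin e → TotalQuot R))

/-- Complement of a prime ideal, with the primality hypothesis explicit. -/
def primeCompl' (p : Ideal R) (hp : p.IsPrime) : Submonoid R :=
  @Ideal.primeCompl R _ p hp

/-- Minimal number of generators of a module. -/
def minGens (E : Type u) [AddCommGroup E] [Module R E] : ℕ :=
  sInf {n | ∃ f : Fin n → E, Submodule.span R (Set.range f) = ⊤}

/-- The grade of an ideal `I` on a module `M`: supremum of lengths of
`M`-regular sequences contained in `I`. -/
def sequenceGrade (I : Ideal R) (M : Type u) [AddCommGroup M] [Module R M] : ℕ∞ :=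
  sSup {n : ℕ∞ | ∃ rs : List R, (rs.length : ℕ∞) = n ∧ (∀ r ∈ rs, r ∈ I) ∧
    RingTheory.Sequence.IsRegular M rs}

/-- Depth of a module over a local ring. -/
def moduleDepth [IsLocalRing R] (M : Type u) [AddCommGroup M] [Module R M] : ℕ∞ :=
  sequenceGrade R (IsLocalRing.maximalIdeal R) M

/-- The grade of a module: grade of its annihilator on `R`. -/
def moduleGrade (M : Type u) [AddCommGroup M] [Module R M] : ℕ∞ :=
  sequenceGrade R (Module.annihilator R M) R

/-- Dimension of a module: Krull dimension of `R` modulo the annihilator. -/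
def moduleDim (M : Type u) [AddCommGroup M] [Module R M] : WithBot ℕ∞ :=
  ringKrullDim (R ⧸ Module.annihilator R M)

/-- Krull dimension of the localization `R_p`. -/
def localDimAt (p : Ideal R) (hp : p.IsPrime) : WithBot ℕ∞ :=
  ringKrullDim (Localization (primeCompl' R p hp))

/-- Height of an ideal: infimum of `dim R_p` over primes `p ⊇ I`. -/
def idealHeight (I : Ideal R) : WithBot ℕ∞ :=
  sInf {d | ∃ (p : Ideal R) (hp : p.IsPrime), I ≤ p ∧ d = localDimAt R p hp}

/-- A local ring is Cohen-Macaulay if its depth equals its dimension. -/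
def IsCMLocalRing [IsLocalRing R] : Prop :=
  (moduleDepth R R : WithBot ℕ∞) = ringKrullDim R

/-- A ring is Cohen-Macaulay if all its localizations at maximal ideals are. -/
def IsCMRing : Prop :=
  ∀ (p : Ideal R), ∀ hp : p.IsMaximal,
    letI : p.IsPrime := hp.isPrime
    (moduleDepth (Localization.AtPrime p) (Localization.AtPrime p) : WithBot ℕ∞)
      = ringKrullDim (Localization.AtPrime p)

/-- A finite module over a local ring is Cohen-Macaulay if it is zero or
its depth equals its dimension. -/
def IsCMModule [IsLocalRing R] (M : Type u) [AddCommGroup M] [Module R M] : Prop :=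
  Subsingleton M ∨ (moduleDepth R M : WithBot ℕ∞) = moduleDim R M

open CategoryTheory in
/-- Vanishing of `Ext_R^n(M, N)`. -/
def extVanish (M N : Type u) [AddCommGroup M] [Module R M] [AddCommGroup N] [Module R N]
    (n : ℕ) : Prop :=
  Subsingleton (((Ext R (ModuleCat.{u} R) n).obj (Opposite.op (ModuleCat.of R M))).obj
    (ModuleCat.of R N))

/-- A Noetherian local ring is Gorenstein iff it is Cohen-Macaulay and `R` has finite
injective dimension, i.e. `Ext^i(k, R) = 0` for all large `i`. -/
def IsGorensteinLocalRing [IsLocalRing R] : Prop :=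
  IsCMLocalRing R ∧ ∃ n : ℕ, ∀ i : ℕ, n < i → extVanish R (IsLocalRing.ResidueField R) R i

variable (E : Type u) [AddCommGroup E] [Module R E]

/-- Defining relations of the symmetric algebra, presented as the free commutative
`R`-algebra on `E` modulo linearity relations. -/
def symRels : Set (MvPolynomial E R) :=
  {p | ∃ x y : E, p = MvPolynomial.X (x + y) - MvPolynomial.X x - MvPolynomial.X y} ∪
  {p | ∃ (r : R) (x : E), p = MvPolynomial.X (r • x) - MvPolynomial.C r * MvPolynomial.X x}

/-- The symmetric algebra of a module. -/
abbrev SymModAlg := MvPolynomial E R ⧸ Ideal.span (symRels R E)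

/-- The `R`-torsion ideal of an `R`-algebra `A`. -/
def torsionIdeal (A : Type u) [CommRing A] [Algebra R A] : Ideal A where
  carrier := {a | ∃ r ∈ nonZeroDivisors R, r • a = 0}
  zero_mem' := ⟨1, one_mem _, smul_zero _⟩
  add_mem' := by
    rintro a b ⟨r, hr, ha⟩ ⟨s, hs, hb⟩
    refine ⟨r * s, mul_mem hr hs, ?_⟩
    have h1 : (r * s) • a = 0 := by rw [mul_comm, mul_smul, ha, smul_zero]
    have h2 : (r * s) • b = 0 := by rw [mul_smul, hb, smul_zero]
    rw [smul_add, h1, h2, add_zero]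
  smul_mem' := by
    rintro c a ⟨r, hr, ha⟩
    exact ⟨r, hr, by rw [smul_comm, ha, smul_zero]⟩

/-- The Rees algebra of a module: the symmetric algebra modulo `R`-torsion. -/
abbrev ReesModAlg := SymModAlg R E ⧸ torsionIdeal R (SymModAlg R E)

/-- The canonical map `E → R(E)`. -/
def reesι (x : E) : ReesModAlg R E :=
  Ideal.Quotient.mk _ (Ideal.Quotient.mk _ (MvPolynomial.X x))

/-- The `j`-th power `E^j` of a module: the `j`-th graded component of its Rees
algebra, i.e. the `R`-span of products of `j` elements of `E`. -/
def reesPower (j : ℕ) : Submodule R (ReesModAlg R E) :=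
  Submodule.span R {a | ∃ f : Fin j → E, a = ∏ i, reesι R E (f i)}

/-- A module is of linear type if its symmetric algebra is `R`-torsion-free,
i.e. the natural surjection `S(E) → R(E)` is an isomorphism. -/
def IsLinearType : Prop := torsionIdeal R (SymModAlg R E) = ⊥

/-- The extension of the maximal ideal to the Rees algebra. -/
def fiberIdeal [IsLocalRing R] : Ideal (ReesModAlg R E) :=
  Ideal.map (algebraMap R (ReesModAlg R E)) (IsLocalRing.maximalIdeal R)

/-- The analytic spread: Krull dimension of the special fiber ring `R(E) ⊗ k`. -/
def analyticSpread [IsLocalRing R] : WithBot ℕ∞ :=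
  ringKrullDim (ReesModAlg R E ⧸ fiberIdeal R E)

/-- The submodule `U·E^r` of the Rees algebra. -/
def mulPower (U : Submodule R E) (r : ℕ) : Submodule R (ReesModAlg R E) :=
  Submodule.span R {a | ∃ u ∈ U, ∃ f : Fin r → E, a = reesι R E u * ∏ i, reesι R E (f i)}

/-- `U` is a reduction of `E` if `E^{r+1} = U·E^r` for some `r`. -/
def IsReduction (U : Submodule R E) : Prop :=
  ∃ r : ℕ, reesPower R E (r + 1) = mulPower R E U r

/-- A minimal reduction. -/
def IsMinimalReduction (U : Submodule R E) : Prop :=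
  IsReduction R E U ∧ ∀ U' : Submodule R E, U' ≤ U → IsReduction R E U' → U' = U

/-- The reduction number of a reduction `U`. -/
def reductionNumberOf (U : Submodule R E) : ℕ :=
  sInf {r | reesPower R E (r + 1) = mulPower R E U r}

/-- The reduction number of `E`. -/
def reductionNumber : ℕ :=
  sInf {r | ∃ U : Submodule R E, IsMinimalReduction R E U ∧ reductionNumberOf R E U = r}

/-- The condition `G_s` for a module of rank `e`:
`μ(E_p) ≤ dim R_p + e - 1` for all primes with `1 ≤ dim R_p ≤ s - 1`. -/
def Gcond (e s : ℕ) : Prop :=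
  ∀ (p : Ideal R) (hp : p.IsPrime),
    (1 : WithBot ℕ∞) ≤ localDimAt R p hp → localDimAt R p hp + 1 ≤ (s : WithBot ℕ∞) →
    (minGens (Localization (primeCompl' R p hp)) (LocalizedModule (primeCompl' R p hp) E)
        : WithBot ℕ∞) ≤ localDimAt R p hp + ((e - 1 : ℕ) : WithBot ℕ∞)

/-- The condition `G_∞` for a module of rank `e`. -/
def GcondInf (e : ℕ) : Prop := ∀ s : ℕ, Gcond R E e s

/-- The condition `G_s` for an ideal: `μ(I_p) ≤ dim R_p` for all primes `p ⊇ I`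
with `dim R_p ≤ s - 1`. -/
def GcondIdeal (I : Ideal R) (s : ℕ) : Prop :=
  ∀ (p : Ideal R) (hp : p.IsPrime), I ≤ p → localDimAt R p hp + 1 ≤ (s : WithBot ℕ∞) →
    (minGens (Localization (primeCompl' R p hp)) (LocalizedModule (primeCompl' R p hp) ↥I)
        : WithBot ℕ∞) ≤ localDimAt R p hp

/-- The `0`-th Fitting ideal of a module. -/
def fitting0 (M : Type u) [AddCommGroup M] [Module R M] : Ideal R :=
  ⨆ (n : ℕ) (π : (Fin n → R) →ₗ[R] M) (_ : Function.Surjective π),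
    Ideal.span {d | ∃ A : Matrix (Fin n) (Fin n) R,
      (∀ jc : Fin n, π (fun i => A i jc) = 0) ∧ d = A.det}

end Defs

lemma aux_baseChange {A B M : Type*} [CommRing A] [CommRing B] [Algebra A B]
    [AddCommGroup M] [Module A M] {e : ℕ} (h : Nonempty (M ≃ₗ[A] (Fin e → A))) :
    Nonempty ((B ⊗[A] M) ≃ₗ[B] (Fin e → B)) := by
  obtain ⟨f⟩ := h
  exact ⟨((Module.Basis.ofEquivFun f).baseChange B).equivFun⟩

lemma aux_tower {R A B E : Type*} [CommRing R] [CommRing A] [CommRing B] [Algebra R A]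
    [Algebra R B] [AddCommGroup E] [Module R E] {e : ℕ} (g : A →ₐ[R] B)
    (h : Nonempty ((A ⊗[R] E) ≃ₗ[A] (Fin e → A))) :
    Nonempty ((B ⊗[R] E) ≃ₗ[B] (Fin e → B)) := by
  let : Algebra A B := g.toRingHom.toAlgebra
  have : IsScalarTower R A B := IsScalarTower.of_algebraMap_eq fun r => (g.commutes r).symm
  obtain ⟨f⟩ := aux_baseChange (B := B) h
  exact ⟨(TensorProduct.AlgebraTensorModule.cancelBaseChange R A B B E).symm ≪≫ₗ f⟩


lemma aux_loc {R E : Type*} [CommRing R] [AddCommGroup E] [Module R E] (S : Submonoid R) (e : ℕ) :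
    Nonempty (LocalizedModule S E ≃ₗ[Localization S] (Fin e → Localization S)) ↔
    Nonempty ((Localization S ⊗[R] E) ≃ₗ[Localization S] (Fin e → Localization S)) :=
  ⟨fun ⟨f⟩ => ⟨(LocalizedModule.equivTensorProduct S E).symm ≪≫ₗ f⟩,
   fun ⟨f⟩ => ⟨(LocalizedModule.equivTensorProduct S E) ≪≫ₗ f⟩⟩

lemma aux_semilocal {K M : Type*} [CommRing K] [Finite (MaximalSpectrum K)]
    [AddCommGroup M] [Module K M] [Module.Finite K M] (e : ℕ)
    (h : ∀ (P : Ideal K) [P.IsMaximal], Nonempty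
      ((Localization.AtPrime P ⊗[K] M) ≃ₗ[Localization.AtPrime P]
        (Fin e → Localization.AtPrime P))) :
    Nonempty (M ≃ₗ[K] (Fin e → K)) := by
  have hflat : Module.Flat K M := by
    apply Module.flat_of_localized_maximal
    intro P hP
    obtain ⟨f⟩ := (aux_loc P.primeCompl e).2 (h P)
    have : Module.Flat (Localization.AtPrime P) (LocalizedModule P.primeCompl M) :=
      Module.Flat.of_linearEquiv f
    exact (Module.flat_iff_of_isLocalization (Localization.AtPrime P) P.primeCompl _).1 this
  obtain ⟨b⟩ := Module.nonempty_basis_of_flat_of_finrank_eq K M e (by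
    rintro ⟨P, hP⟩
    let := Ideal.Quotient.field P
    obtain ⟨f⟩ := aux_tower (B := P.ResidueField)
      (IsScalarTower.toAlgHom K (Localization.AtPrime P) P.ResidueField) (h P)
    have h1 := (TensorProduct.AlgebraTensorModule.cancelBaseChange K (K ⧸ P) P.ResidueField
      P.ResidueField M ≪≫ₗ f).finrank_eq
    rw [Module.finrank_baseChange] at h1
    simpa using h1)
  exact ⟨b.equivFun⟩

/-- Over a Noetherian ring, a finite module has rank `e` iff it is
free of rank `e` at every associated prime of `R`. -/
theorem statement_0 (R : Type u) [CommRing R] [IsNoetherianRing R]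
    (E : Type u) [AddCommGroup E] [Module R E] [Module.Finite R E] (e : ℕ) :
    HasRank R E e ↔
      ∀ (p : Ideal R) (hp : p.IsPrime), IsAssociatedPrime p R →
        Nonempty ((LocalizedModule (primeCompl' R p hp) E)
          ≃ₗ[Localization (primeCompl' R p hp)]
            (Fin e → Localization (primeCompl' R p hp))) := by
  constructor
  · intro h p hp hass
    rw [aux_loc]
    have hle : nonZeroDivisors R ≤ primeCompl' R p hp := by
      intro x hx hxp
      have : x ∈ ⋃ q ∈ associatedPrimes R R, (q : Set R) := Set.mem_biUnion hass hxp
      rw [biUnion_associatedPrimes_eq_compl_nonZeroDivisors] at this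
      exact this hx
    refine aux_tower (A := TotalQuot R) (IsLocalization.liftAlgHom (M := nonZeroDivisors R)
      (f := Algebra.ofId R _) fun y => ?_) h
    exact IsLocalization.map_units (Localization (primeCompl' R p hp))
      (⟨y.1, hle y.2⟩ : primeCompl' R p hp)
  · intro h
    have : IsNoetherianRing (TotalQuot R) :=
      IsLocalization.isNoetherianRing (nonZeroDivisors R) _ inferInstance
    have : IsFractionRing (TotalQuot R) (TotalQuot R) := IsFractionRing.idem R _
    refine aux_semilocal e fun P hP => ?_
    have hass := Ideal.IsMaximal.mem_associatedPrimes_of_isFractionRing (A := TotalQuot R) P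
    rw [← Module.associatedPrimes.preimage_comap_associatedPrimes_eq_associatedPrimes_of_isLocalizedModule
      (nonZeroDivisors R) (TotalQuot R) (Algebra.linearMap R (TotalQuot R))] at hass
    have h1 := h _ inferInstance hass
    rw [aux_loc] at h1
    have := IsLocalization.isLocalization_isLocalization_atPrime_isLocalization
      (nonZeroDivisors R) (Localization.AtPrime P) P
    obtain ⟨f⟩ := aux_tower (B := Localization.AtPrime P) (IsLocalization.liftAlgHom
      (M := primeCompl' R (P.comap (algebraMap R (TotalQuot R))) inferInstance)
      (f := Algebra.ofId R _) fun y =>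
        IsLocalization.map_units (M := Ideal.primeCompl (P.comap (algebraMap R (TotalQuot R))))
          (Localization.AtPrime P) y) h1
    exact ⟨TensorProduct.AlgebraTensorModule.cancelBaseChange R (TotalQuot R) _ _ E ≪≫ₗ f⟩
end
end

section
/- Let R be a Noetherian local ring of dimension d > 0 with infinite residue field, and let E be a finitely generated R-module with rank e > 0. Then the analytic spread ℓ(E) satisfies e ≤ ℓ(E) ≤ d + e − 1. -/
open scoped TensorProduct

noncomputable section

universe u

theorem aux_dim_step {B S : Type u} [CommRing B] [IsDomain B] [IsNoetherianRing B] [CommRing S]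
    [IsDomain S] [Algebra B S] (_hinj : Function.Injective (algebraMap B S)) (a : S)
    (ha : IsAlgebraic B a) :
    ringKrullDim (Algebra.adjoin B {a}) ≤ ringKrullDim B := by
  obtain ⟨f, hf0, hf⟩ := ha
  refine (ringKrullDim_eq_of_ringEquiv (Subalgebra.equivOfEq _ _
    (Algebra.adjoin_singleton_eq_range_aeval B a)).toRingEquiv).trans_le ?_
  have h := ringKrullDim_succ_le_of_surjective (Polynomial.aeval (R := B) a).rangeRestrict.toRingHom
    (AlgHom.rangeRestrict_surjective _) (r := f) (mem_nonZeroDivisors_of_ne_zero hf0)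
    (by ext; simpa using hf)
  rw [Polynomial.ringKrullDim_of_isNoetherianRing] at h
  exact ENat.WithBot.add_le_add_one_right_iff.1 h

theorem aux_dim_alg {A S : Type u} [CommRing A] [IsDomain A] [IsNoetherianRing A] [CommRing S]
    [IsDomain S] [Algebra A S] (hinj : Function.Injective (algebraMap A S))
    [Algebra.IsAlgebraic A S] [hft : Algebra.FiniteType A S] :
    ringKrullDim S ≤ ringKrullDim A := by
  classical
  obtain ⟨s, hs⟩ := hft.out
  have key : ∀ t : Finset S, ringKrullDim (Algebra.adjoin A (t : Set S)) ≤ ringKrullDim A := by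
    intro t
    induction t using Finset.induction_on with
    | empty =>
      rw [Finset.coe_empty, Algebra.adjoin_empty]
      exact (ringKrullDim_eq_of_ringEquiv
        (Algebra.botEquivOfInjective hinj).toRingEquiv).le
    | insert a t _ ih =>
      refine le_trans ?_ ih
      rw [Finset.coe_insert, Set.insert_eq, Set.union_comm, Algebra.adjoin_union_eq_adjoin_adjoin]
      have : IsNoetherianRing (Algebra.adjoin A (t : Set S)) := by
        have : Algebra.FiniteType A (Algebra.adjoin A (t : Set S)) :=
          (Subalgebra.fg_iff_finiteType _).1 ⟨t, rfl⟩
        exact Algebra.FiniteType.isNoetherianRing A _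
      have halg : IsAlgebraic (Algebra.adjoin A (t : Set S)) a :=
        (Algebra.IsAlgebraic.isAlgebraic (R := A) a).extendScalars (by
          intro x y h
          apply hinj
          exact congrArg Subtype.val h)
      exact aux_dim_step (B := Algebra.adjoin A (t : Set S)) Subtype.val_injective a halg
  have := key s
  rw [hs] at this
  exact (ringKrullDim_eq_of_ringEquiv (Subalgebra.topEquiv (R := A) (A := S)).toRingEquiv).symm.le.trans this

theorem aux_dim_trdeg {A S : Type u} [CommRing A] [IsDomain A] [IsNoetherianRing A] [CommRing S]
    [IsDomain S] [Algebra A S] (hinj : Function.Injective (algebraMap A S))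
    [hft : Algebra.FiniteType A S] (e : ℕ) (he : Algebra.trdeg A S ≤ e) :
    ringKrullDim S ≤ ringKrullDim A + e := by
  have : FaithfulSMul A S := (faithfulSMul_iff_algebraMap_injective A S).2 hinj
  obtain ⟨s, hs⟩ := exists_isTranscendenceBasis A S
  have hc := hs.cardinalMk_eq_trdeg
  have hle : Cardinal.mk s ≤ e := hc.trans_le he
  have hfin : Finite s := by
    rw [← Cardinal.lt_aleph0_iff_finite]
    exact hle.trans_lt (Cardinal.natCast_lt_aleph0)
  have hcard : Nat.card s ≤ e := by
    rw [← Nat.cast_card] at hle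
    exact_mod_cast hle
  let A' := Algebra.adjoin A (Set.range ((↑) : s → S))
  have e1 : MvPolynomial s A ≃ₐ[A] A' := hs.1.aevalEquiv
  have : IsNoetherianRing A' := isNoetherianRing_of_ringEquiv _ e1.toRingEquiv
  have : Algebra.IsAlgebraic A' S := hs.isAlgebraic
  have : Algebra.FiniteType A' S := Algebra.FiniteType.of_restrictScalars_finiteType A A' S
  refine (aux_dim_alg (A := A') (S := S) Subtype.val_injective).trans ?_
  rw [← ringKrullDim_eq_of_ringEquiv e1.toRingEquiv, MvPolynomial.ringKrullDim_of_isNoetherianRing]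
  gcongr

/-- dimension of a domain quotient drops strictly. -/
theorem aux_quot_lt {A : Type u} [CommRing A] (Q P : Ideal A) [Q.IsPrime] (h : Q < P) :
    ringKrullDim (A ⧸ P) + 1 ≤ ringKrullDim (A ⧸ Q) := by
  obtain ⟨x, hxP, hxQ⟩ := SetLike.exists_of_lt h
  refine ringKrullDim_succ_le_of_surjective (Ideal.Quotient.factor h.le)
    (Ideal.Quotient.factor_surjective h.le) (r := Ideal.Quotient.mk Q x) ?_ ?_
  · apply mem_nonZeroDivisors_of_ne_zero
    rwa [Ne, Ideal.Quotient.eq_zero_iff_mem]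
  · simpa [Ideal.Quotient.eq_zero_iff_mem] using hxP

/-- dimension of a quotient bounded by those at minimal primes -/
theorem aux_quot_le {A : Type u} [CommRing A] (I : Ideal A) (n : WithBot ℕ∞)
    (h : ∀ P : Ideal A, P.IsPrime → I ≤ P → ringKrullDim (A ⧸ P) ≤ n) :
    ringKrullDim (A ⧸ I) ≤ n := by
  rw [ringKrullDim_quotient, Order.krullDim]
  refine iSup_le fun l => ?_
  have hI : I ≤ l.head.1.asIdeal := l.head.2
  refine le_trans ?_ (h _ l.head.1.2 hI)
  rw [ringKrullDim_quotient, Order.krullDim]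
  let l' : LTSeries (PrimeSpectrum.zeroLocus (R := A) (l.head.1.asIdeal : Set A)) :=
    ⟨l.length, fun i => ⟨(l i).1, LTSeries.head_le l i⟩, fun i => l.step i⟩
  exact le_iSup (fun p : LTSeries _ => ((p.length : ℕ∞) : WithBot ℕ∞)) l'
section ReesAux
variable (R : Type u) [CommRing R] (E : Type u) [AddCommGroup E] [Module R E]

/-- Lift a linear map to the symmetric algebra. -/
def auxSymLift {C : Type u} [CommRing C] [Algebra R C] (f : E →ₗ[R] C) :
    SymModAlg R E →ₐ[R] C :=
  Ideal.Quotient.liftₐ _ (MvPolynomial.aeval f) (by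
    intro a ha
    have : Ideal.span (symRels R E) ≤ RingHom.ker (MvPolynomial.aeval (R := R) f) := by
      rw [Ideal.span_le]
      rintro p (⟨x, y, rfl⟩ | ⟨r, x, rfl⟩)
      · simp [RingHom.mem_ker]
      · simp [RingHom.mem_ker, Algebra.smul_def]
    exact this ha)

/-- The canonical map to the symmetric algebra. -/
def auxSymι : E →ₗ[R] SymModAlg R E where
  toFun x := Ideal.Quotient.mk _ (MvPolynomial.X x)
  map_add' x y := by
    rw [← map_add, Ideal.Quotient.eq, ← sub_sub]
    exact Ideal.subset_span (Or.inl ⟨x, y, rfl⟩)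
  map_smul' r x := by
    have h : Ideal.Quotient.mk (Ideal.span (symRels R E)) (MvPolynomial.X (r • x)) =
        Ideal.Quotient.mk _ (MvPolynomial.C r * MvPolynomial.X x) := by
      rw [Ideal.Quotient.eq]
      exact Ideal.subset_span (Or.inr ⟨r, x, rfl⟩)
    rw [h, map_mul, RingHom.id_apply]
    exact (Algebra.smul_def (A := SymModAlg R E) r _).symm

theorem auxSymLift_ι {C : Type u} [CommRing C] [Algebra R C] (f : E →ₗ[R] C) (x : E) :
    auxSymLift R E f (auxSymι R E x) = f x := by
  change MvPolynomial.aeval f (MvPolynomial.X x) = _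
  simp

theorem auxSym_hom_ext {C : Type u} [CommRing C] [Algebra R C] {f g : SymModAlg R E →ₐ[R] C}
    (h : ∀ x, f (auxSymι R E x) = g (auxSymι R E x)) : f = g := by
  apply Ideal.Quotient.algHom_ext
  apply MvPolynomial.algHom_ext
  exact h

/-- Lift an algebra map to the Rees algebra. -/
def auxReesLift {C : Type u} [CommRing C] [Algebra R C]
    (hC : ∀ r ∈ nonZeroDivisors R, ∀ c : C, r • c = 0 → c = 0) (f : E →ₗ[R] C) :
    ReesModAlg R E →ₐ[R] C :=
  Ideal.Quotient.liftₐ _ (auxSymLift R E f) (by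
    rintro a ⟨r, hr, ha⟩
    apply hC r hr
    rw [← map_smul, ha, map_zero])

theorem auxReesLift_ι {C : Type u} [CommRing C] [Algebra R C]
    (hC : ∀ r ∈ nonZeroDivisors R, ∀ c : C, r • c = 0 → c = 0) (f : E →ₗ[R] C) (x : E) :
    auxReesLift R E hC f (reesι R E x) = f x :=
  auxSymLift_ι R E f x

theorem auxRees_hom_ext {C : Type u} [CommRing C] [Algebra R C] {f g : ReesModAlg R E →ₐ[R] C}
    (h : ∀ x, f (reesι R E x) = g (reesι R E x)) : f = g := by
  apply Ideal.Quotient.algHom_ext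
  apply auxSym_hom_ext
  exact h

theorem auxSym_finiteType [Module.Finite R E] : Algebra.FiniteType R (SymModAlg R E) := by
  obtain ⟨s, hs⟩ := Module.Finite.fg_top (R := R) (M := E)
  have hE : ∀ x : E, auxSymι R E x ∈ Algebra.adjoin R (auxSymι R E '' s) := by
    intro x
    have hx : x ∈ Submodule.span R (s : Set E) := hs ▸ Submodule.mem_top
    have h2 : Submodule.span R (s : Set E) ≤
        (Subalgebra.toSubmodule (Algebra.adjoin R (auxSymι R E '' s))).comap (auxSymι R E) := by
      rw [Submodule.span_le]
      intro y hy
      exact Algebra.subset_adjoin ⟨y, hy, rfl⟩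
    exact h2 hx
  classical
  refine ⟨⟨s.image (auxSymι R E), ?_⟩⟩
  rw [Finset.coe_image, eq_top_iff]
  rintro a -
  obtain ⟨p, rfl⟩ := Ideal.Quotient.mk_surjective a
  induction p using MvPolynomial.induction_on with
  | C r => exact Subalgebra.algebraMap_mem _ r
  | add p q hp hq => rw [map_add]; exact add_mem hp hq
  | mul_X p x hp => rw [map_mul]; exact mul_mem hp (hE x)

instance auxRees_finiteType [Module.Finite R E] : Algebra.FiniteType R (ReesModAlg R E) := by
  have := auxSym_finiteType R E
  exact Algebra.FiniteType.of_surjective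
    (Ideal.Quotient.mkₐ R (torsionIdeal R (SymModAlg R E))) (Ideal.Quotient.mkₐ_surjective _ _)

theorem auxTorsionFreeB (e : ℕ) : ∀ r ∈ nonZeroDivisors R,
    ∀ c : MvPolynomial (Fin e) (TotalQuot R), r • c = 0 → c = 0 := by
  intro r hr c h
  have hu : IsUnit (algebraMap R (TotalQuot R) r) := IsLocalization.map_units _ (⟨r, hr⟩ : nonZeroDivisors R)
  rw [← IsScalarTower.algebraMap_smul (TotalQuot R) r c] at h
  exact (hu.smul_eq_zero).1 h

/-- The linear map `E → Quot(R)[T]`. -/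
def auxLin {e : ℕ} (φ : (TotalQuot R ⊗[R] E) ≃ₗ[TotalQuot R] (Fin e → TotalQuot R)) :
    E →ₗ[R] MvPolynomial (Fin e) (TotalQuot R) where
  toFun x := ∑ i, φ (1 ⊗ₜ x) i • MvPolynomial.X i
  map_add' x y := by
    simp [TensorProduct.tmul_add, add_smul, Finset.sum_add_distrib]
  map_smul' r x := by
    have : φ (1 ⊗ₜ (r • x)) = r • φ (1 ⊗ₜ x) := by
      rw [TensorProduct.tmul_smul, ← IsScalarTower.algebraMap_smul (TotalQuot R) r (_ ⊗ₜ[R] _),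
        map_smul, IsScalarTower.algebraMap_smul]
    rw [this]
    simp [Finset.smul_sum, smul_assoc]

theorem auxLin_apply {e : ℕ} (φ : (TotalQuot R ⊗[R] E) ≃ₗ[TotalQuot R] (Fin e → TotalQuot R))
    (x : E) : auxLin R E φ x = ∑ i, φ (1 ⊗ₜ x) i • MvPolynomial.X i := rfl

/-- The embedding of the Rees algebra in `Quot(R)[T]`. -/
def auxPsi {e : ℕ} (φ : (TotalQuot R ⊗[R] E) ≃ₗ[TotalQuot R] (Fin e → TotalQuot R)) :
    ReesModAlg R E →ₐ[R] MvPolynomial (Fin e) (TotalQuot R) :=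
  auxReesLift R E (auxTorsionFreeB R e) (auxLin R E φ)

theorem auxPsi_ι {e : ℕ} (φ : (TotalQuot R ⊗[R] E) ≃ₗ[TotalQuot R] (Fin e → TotalQuot R))
    (x : E) : auxPsi R E φ (reesι R E x) = ∑ i, φ (1 ⊗ₜ x) i • MvPolynomial.X i :=
  auxReesLift_ι R E _ _ x

theorem auxPsi_injective {e : ℕ}
    (φ : (TotalQuot R ⊗[R] E) ≃ₗ[TotalQuot R] (Fin e → TotalQuot R)) :
    Function.Injective (auxPsi R E φ) := by
  rw [injective_iff_map_eq_zero]
  intro a ha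
  obtain ⟨s, rfl⟩ := Ideal.Quotient.mk_surjective a
  replace ha : auxSymLift R E (auxLin R E φ) s = 0 := ha
  let Φ : MvPolynomial (Fin e) (TotalQuot R) →ₐ[TotalQuot R] TotalQuot R ⊗[R] SymModAlg R E :=
    MvPolynomial.aeval (fun i => (auxSymι R E).baseChange (TotalQuot R) (φ.symm (Pi.single i 1)))
  have hcomp : (Φ.restrictScalars R).comp (auxSymLift R E (auxLin R E φ)) =
      Algebra.TensorProduct.includeRight := by
    refine auxSym_hom_ext R E (C := TotalQuot R ⊗[R] SymModAlg R E) ?_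
    intro x
    rw [AlgHom.comp_apply, auxSymLift_ι, auxLin_apply]
    have h1 : (1 : TotalQuot R) ⊗ₜ[R] x = ∑ i, φ (1 ⊗ₜ x) i • φ.symm (Pi.single i 1) := by
      apply φ.injective
      rw [map_sum]
      ext j
      simp [Finset.sum_apply, Pi.single_apply]
    change Φ _ = 1 ⊗ₜ[R] auxSymι R E x
    have h2 := congrArg ((auxSymι R E).baseChange (TotalQuot R)) h1
    rw [LinearMap.baseChange_tmul, map_sum] at h2
    rw [h2, map_sum]
    simp [Φ]
  have h0 : (1 : TotalQuot R) ⊗ₜ[R] s = 0 := by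
    have := DFunLike.congr_fun hcomp s
    rw [AlgHom.comp_apply, ha, map_zero] at this
    exact this.symm
  have hloc : IsLocalizedModule (nonZeroDivisors R)
      (TensorProduct.mk R (TotalQuot R) (SymModAlg R E) 1) := inferInstance
  obtain ⟨r, hr⟩ := (IsLocalizedModule.eq_zero_iff (nonZeroDivisors R)
      (TensorProduct.mk R (TotalQuot R) (SymModAlg R E) 1)).1 h0
  rw [Ideal.Quotient.eq_zero_iff_mem]
  exact ⟨r, r.2, hr⟩

/-- Elements of `E` mapping to unit multiples of the variables. -/
theorem auxPsi_var {e : ℕ}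
    (φ : (TotalQuot R ⊗[R] E) ≃ₗ[TotalQuot R] (Fin e → TotalQuot R)) (i : Fin e) :
    ∃ x : E, ∃ w : TotalQuot R, IsUnit w ∧
      auxPsi R E φ (reesι R E x) = w • MvPolynomial.X i := by
  obtain ⟨⟨x, w⟩, hx⟩ := IsLocalizedModule.surj (nonZeroDivisors R)
    (TensorProduct.mk R (TotalQuot R) E 1) (φ.symm (Pi.single i 1))
  refine ⟨x, algebraMap R _ w, IsLocalization.map_units _ w, ?_⟩
  have hx' : (1 : TotalQuot R) ⊗ₜ[R] x =
      algebraMap R (TotalQuot R) w • φ.symm (Pi.single i 1) := by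
    rw [IsScalarTower.algebraMap_smul]; exact hx.symm
  rw [auxPsi_ι, hx', map_smul, LinearEquiv.apply_symm_apply, Finset.sum_eq_single i]
  · simp
  · intro j _ hj
    simp [Pi.single_eq_of_ne hj]
  · simp

/-- The augmentation. -/
def auxAug : ReesModAlg R E →ₐ[R] R :=
  auxReesLift R E (fun _ hr c h => (mem_nonZeroDivisors_iff.1 hr).1 c h) 0

end ReesAux
section Bounds
variable (R : Type u) [CommRing R] (E : Type u) [AddCommGroup E] [Module R E]

theorem auxAug_ι (x : E) : auxAug R E (reesι R E x) = 0 :=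
  auxReesLift_ι R E _ _ x

/-- Height of the augmentation pullback of a minimal prime. -/
theorem aux_height_min {e : ℕ}
    (φ : (TotalQuot R ⊗[R] E) ≃ₗ[TotalQuot R] (Fin e → TotalQuot R))
    (p : Ideal R) (hp : p ∈ minimalPrimes R) :
    (e : ℕ∞) ≤ (p.comap (auxAug R E)).height := by
  obtain ⟨p', hp', hpp⟩ := Ideal.exists_comap_eq_of_mem_minimalPrimes_of_injective
    (IsLocalization.injective (TotalQuot R) (le_refl (nonZeroDivisors R))) p hp
  let g : ℕ → Fin e → MvPolynomial (Fin e) (TotalQuot R ⧸ p') :=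
    fun j i => if i.val < j then 0 else MvPolynomial.X i
  let h : ℕ → ReesModAlg R E →ₐ[R] MvPolynomial (Fin e) (TotalQuot R ⧸ p') := fun j =>
    ((MvPolynomial.aeval (R := TotalQuot R) (g j)).restrictScalars R).comp (auxPsi R E φ)
  have hprime : ∀ j, (RingHom.ker (h j)).IsPrime := fun j => RingHom.ker_isPrime _
  have hmono : ∀ j, RingHom.ker (h j) ≤ RingHom.ker (h (j + 1)) := by
    intro j a ha
    have hc : ((MvPolynomial.aeval (R := TotalQuot R ⧸ p') (g (j + 1))).restrictScalars
        (TotalQuot R)).comp (MvPolynomial.aeval (R := TotalQuot R) (g j)) =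
        MvPolynomial.aeval (R := TotalQuot R) (g (j + 1)) := by
      apply MvPolynomial.algHom_ext
      intro i
      by_cases hi : i.val < j
      · simp [g, hi, Nat.le_of_lt hi]
      · simp [g, hi]
    rw [RingHom.mem_ker] at ha ⊢
    have h2 : h (j + 1) a = MvPolynomial.aeval (R := TotalQuot R ⧸ p') (g (j + 1)) (h j a) :=
      (DFunLike.congr_fun hc (auxPsi R E φ a)).symm
    rw [h2, ha, map_zero]
  have hlt : ∀ j, j < e → RingHom.ker (h j) < RingHom.ker (h (j + 1)) := by
    intro j hj
    obtain ⟨x, w, hw, hx⟩ := auxPsi_var R E φ ⟨j, hj⟩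
    have hh : ∀ n, h n (reesι R E x) = w • g n ⟨j, hj⟩ := by
      intro n
      change MvPolynomial.aeval (R := TotalQuot R) (g n) (auxPsi R E φ (reesι R E x)) = _
      rw [hx, map_smul, MvPolynomial.aeval_X]
    refine lt_of_le_of_ne (hmono j) fun heq => ?_
    have h1 : reesι R E x ∈ RingHom.ker (h (j + 1)) := by
      rw [RingHom.mem_ker, hh]
      simp [g]
    rw [← heq, RingHom.mem_ker, hh, hw.smul_eq_zero] at h1
    simp [g] at h1
  have hht : ∀ j, j ≤ e → (j : ℕ∞) ≤ (RingHom.ker (h j)).height := by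
    intro j
    induction j with
    | zero => simp
    | succ j ih =>
      intro hj
      have := hprime j
      have := hprime (j + 1)
      refine le_trans ?_ (Ideal.height_add_one_le_of_lt_of_isPrime (hlt j hj))
      push_cast
      gcongr
      exact ih (by omega)
  have hend : h e = (Algebra.ofId R _).comp (auxAug R E) := by
    refine auxRees_hom_ext R E (C := MvPolynomial (Fin e) (TotalQuot R ⧸ p')) ?_
    intro x
    rw [AlgHom.comp_apply (Algebra.ofId R _), auxAug_ι, map_zero]
    change MvPolynomial.aeval (R := TotalQuot R) (g e) (auxPsi R E φ (reesι R E x)) = _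
    rw [auxPsi_ι, map_sum]
    apply Finset.sum_eq_zero
    intro i _
    rw [map_smul, MvPolynomial.aeval_X]
    simp [g]
  have hker : RingHom.ker (h e) = p.comap (auxAug R E) := by
    ext a
    rw [RingHom.mem_ker, hend, Ideal.mem_comap, ← hpp, Ideal.mem_comap,
      ← Ideal.Quotient.eq_zero_iff_mem]
    exact MvPolynomial.C_eq_zero
  rw [← hker]
  exact hht e le_rfl

theorem aux_height_chain {e : ℕ}
    (φ : (TotalQuot R ⊗[R] E) ≃ₗ[TotalQuot R] (Fin e → TotalQuot R))
    (l : LTSeries (PrimeSpectrum R)) (n : ℕ) (hn : n < l.length + 1) :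
    ((e + n : ℕ) : ℕ∞) ≤ ((l ⟨n, hn⟩).asIdeal.comap (auxAug R E)).height := by
  have hsurj : Function.Surjective (auxAug R E) := fun r =>
    ⟨algebraMap R _ r, by simp⟩
  induction n with
  | zero =>
    obtain ⟨p, hp, hple⟩ := Ideal.exists_minimalPrimes_le (I := (⊥ : Ideal R))
      (J := (l ⟨0, hn⟩).asIdeal) bot_le
    exact (aux_height_min R E φ p hp).trans (Ideal.height_mono (Ideal.comap_mono hple))
  | succ n ih =>
    have hlt : l ⟨n, by omega⟩ < l ⟨n + 1, hn⟩ := l.strictMono (by simp)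
    have hlt2 : (l ⟨n, by omega⟩).asIdeal.comap (auxAug R E) <
        (l ⟨n + 1, hn⟩).asIdeal.comap (auxAug R E) := by
      refine lt_of_le_of_ne (Ideal.comap_mono hlt.le) fun heq => ?_
      have := Ideal.comap_injective_of_surjective (auxAug R E) hsurj heq
      exact hlt.ne (PrimeSpectrum.ext this)
    refine le_trans ?_ (Ideal.height_add_one_le_of_lt_of_isPrime hlt2)
    rw [← add_assoc, Nat.cast_succ]
    gcongr
    exact ih _

theorem aux_lower [IsLocalRing R] [IsNoetherianRing R] [Module.Finite R E] (d e : ℕ)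
    (hd : ringKrullDim R = (d : WithBot ℕ∞))
    (φ : (TotalQuot R ⊗[R] E) ≃ₗ[TotalQuot R] (Fin e → TotalQuot R)) :
    (e : WithBot ℕ∞) ≤ analyticSpread R E := by
  have : IsNoetherianRing (ReesModAlg R E) := Algebra.FiniteType.isNoetherianRing R _
  let m := IsLocalRing.maximalIdeal R
  let P : Ideal (ReesModAlg R E) := m.comap (auxAug R E)
  have hPp : P.IsPrime := inferInstanceAs (m.comap (auxAug R E)).IsPrime
  have hPm : P.LiesOver m := ⟨by
    ext r
    simp [P, Ideal.under, Ideal.mem_comap]⟩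
  have hmh : m.height = d := by
    have := IsLocalRing.maximalIdeal_height_eq_ringKrullDim (R := R)
    rw [hd] at this
    exact_mod_cast this
  have hPh : ((e + d : ℕ) : ℕ∞) ≤ P.height := by
    obtain ⟨l, hl⟩ : ∃ l : LTSeries (PrimeSpectrum R), l.length = d := by
      refine Order.le_krullDim_iff.1 ?_
      exact hd.ge
    have h1 := aux_height_chain R E φ l d (by omega)
    exact h1.trans (Ideal.height_mono (Ideal.comap_mono (IsLocalRing.le_maximalIdeal
      (l ⟨d, by omega⟩).2.ne_top)))
  have h := Ideal.height_le_height_add_of_liesOver m P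
  rw [hmh] at h
  have h2 := hPh.trans h
  rw [add_comm e d, Nat.cast_add] at h2
  have h3 : (e : ℕ∞) ≤ _ := (ENat.add_le_add_iff_left (ENat.natCast_ne_top d)).1 h2
  have hne : P.map (Ideal.Quotient.mk (m.map (algebraMap R (ReesModAlg R E)))) ≠ ⊤ := by
    have hle : m.map (algebraMap R (ReesModAlg R E)) ≤ P := by
      rw [Ideal.map_le_iff_le_comap]
      exact hPm.over.le
    have := Ideal.map_isPrime_of_surjective (f := Ideal.Quotient.mk (m.map (algebraMap R (ReesModAlg R E))))
      Ideal.Quotient.mk_surjective (I := P) (by rwa [Ideal.mk_ker])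
    exact this.ne_top
  have h4 := Ideal.height_le_ringKrullDim_of_ne_top hne
  refine le_trans ?_ h4
  exact_mod_cast h3

theorem aux_trdeg_gen {A D K : Type u} [CommRing A] [CommRing D] [IsDomain D] [Algebra A D]
    (hinj : Function.Injective (algebraMap A D)) [CommRing K] {e : ℕ}
    (f : MvPolynomial (Fin e) K →+* D) (hf : Function.Surjective f)
    (hK : ∀ q : K, IsAlgebraic A (f (MvPolynomial.C q))) : Algebra.trdeg A D ≤ e := by
  let s : Set D := Set.range fun i => f (MvPolynomial.X i)
  have hcard : Cardinal.mk s ≤ e := by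
    have := Cardinal.mk_range_le_lift (f := fun i : Fin e => f (MvPolynomial.X i))
    simpa using this
  refine le_trans ?_ hcard
  have : Algebra.IsAlgebraic (Algebra.adjoin A s) D := by
    refine ⟨fun b => ?_⟩
    obtain ⟨b, rfl⟩ := hf b
    induction b using MvPolynomial.induction_on with
    | C q => exact (hK q).extendScalars (fun x y h => hinj (congrArg Subtype.val h))
    | add p q hp hq => rw [map_add]; exact hp.add hq
    | mul_X p i hp =>
      rw [map_mul]
      refine hp.mul ?_
      exact isAlgebraic_algebraMap (A := D)
        (⟨_, Algebra.subset_adjoin ⟨i, rfl⟩⟩ : Algebra.adjoin A s)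
  exact Algebra.IsAlgebraic.trdeg_le_cardinalMk _ s

theorem aux_trdeg {e : ℕ} (Q' : Ideal (MvPolynomial (Fin e) (TotalQuot R))) [Q'.IsPrime] :
    Algebra.trdeg (R ⧸ Q'.under R) (MvPolynomial (Fin e) (TotalQuot R) ⧸ Q') ≤ e := by
  refine aux_trdeg_gen Ideal.algebraMap_quotient_injective (Ideal.Quotient.mk Q')
    Ideal.Quotient.mk_surjective fun q => ?_
  obtain ⟨⟨r, w⟩, hrw⟩ := IsLocalization.surj (nonZeroDivisors R) q
  refine ⟨Polynomial.C (Ideal.Quotient.mk _ (w : R)) * Polynomial.X -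
    Polynomial.C (Ideal.Quotient.mk _ r), ?_, ?_⟩
  · intro hz
    have h1 := congrArg (fun f => Polynomial.coeff f 1) hz
    simp only [Polynomial.coeff_sub, Polynomial.coeff_C_mul, Polynomial.coeff_X_one, mul_one,
      Polynomial.coeff_C_succ, sub_zero, Polynomial.coeff_zero] at h1
    rw [Ideal.Quotient.eq_zero_iff_mem] at h1
    have hu : IsUnit (algebraMap R (MvPolynomial (Fin e) (TotalQuot R)) w) := by
      rw [IsScalarTower.algebraMap_apply R (TotalQuot R) (MvPolynomial (Fin e) (TotalQuot R))]
      exact (IsLocalization.map_units (TotalQuot R) w).map _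
    exact (inferInstance : Q'.IsPrime).ne_top (Ideal.eq_top_of_isUnit_mem _ h1 hu)
  · have h2 : algebraMap R (MvPolynomial (Fin e) (TotalQuot R)) w * MvPolynomial.C q =
        algebraMap R (MvPolynomial (Fin e) (TotalQuot R)) r := by
      rw [IsScalarTower.algebraMap_apply R (TotalQuot R) (MvPolynomial (Fin e) (TotalQuot R)),
        IsScalarTower.algebraMap_apply R (TotalQuot R) (MvPolynomial (Fin e) (TotalQuot R)),
        MvPolynomial.algebraMap_eq, ← map_mul, mul_comm, hrw]
    have h3 := congrArg (Ideal.Quotient.mk Q') h2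
    rw [map_mul] at h3
    simp only [map_sub, map_mul, Polynomial.aeval_C, Polynomial.aeval_X]
    exact sub_eq_zero.2 h3

theorem aux_dim_quot {R S B : Type u} [CommRing R] [IsNoetherianRing R] [CommRing S] [CommRing B]
    [Algebra R S] [Algebra R B] [Algebra.FiniteType R S] (ψ : S →ₐ[R] B) (Q' : Ideal B)
    [Q'.IsPrime] (Q : Ideal S) [Q.IsPrime] (hQ : Q = Q'.comap ψ.toRingHom) (e : ℕ)
    (he : Algebra.trdeg (R ⧸ Q'.under R) (B ⧸ Q') ≤ e) :
    ringKrullDim (S ⧸ Q) ≤ ringKrullDim R + e := by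
  have hQlies : Q.LiesOver (Q'.under R) := ⟨by
    rw [hQ]
    ext r
    simp [Ideal.under, Ideal.mem_comap]⟩
  have hft : Algebra.FiniteType (R ⧸ Q'.under R) (S ⧸ Q) := by
    have : Algebra.FiniteType R (S ⧸ Q) := inferInstance
    exact Algebra.FiniteType.of_restrictScalars_finiteType R _ _
  let F : (S ⧸ Q) →ₐ[R ⧸ Q'.under R] (B ⧸ Q') :=
    { Ideal.quotientMap Q' ψ.toRingHom hQ.le with
      commutes' := by
        intro r
        obtain ⟨r, rfl⟩ := Ideal.Quotient.mk_surjective r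
        exact congrArg (Ideal.Quotient.mk Q') (ψ.commutes r) }
  have hF : Function.Injective F := Ideal.quotientMap_injective' (H := hQ.le) hQ.ge
  have htr : Algebra.trdeg (R ⧸ Q'.under R) (S ⧸ Q) ≤ e :=
    (trdeg_le_of_injective F hF).trans he
  have hinj : Function.Injective (algebraMap (R ⧸ Q'.under R) (S ⧸ Q)) := by
    rw [injective_iff_map_eq_zero]
    intro r hr
    obtain ⟨r, rfl⟩ := Ideal.Quotient.mk_surjective r
    have h1 : Ideal.Quotient.mk Q (algebraMap R S r) = 0 := hr
    rw [Ideal.Quotient.eq_zero_iff_mem] at h1 ⊢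
    rw [hQlies.over]
    exact h1
  refine (aux_dim_trdeg (A := R ⧸ Q'.under R) (S := S ⧸ Q) hinj e htr).trans ?_
  gcongr
  exact ringKrullDim_quotient_le (Q'.under R)

theorem aux_upper [IsLocalRing R] [IsNoetherianRing R] [Module.Finite R E] (d e : ℕ)
    (hd : ringKrullDim R = (d : WithBot ℕ∞)) (hd0 : 0 < d)
    (φ : (TotalQuot R ⊗[R] E) ≃ₗ[TotalQuot R] (Fin e → TotalQuot R)) :
    analyticSpread R E ≤ ((d + e - 1 : ℕ) : WithBot ℕ∞) := by
  refine aux_quot_le _ _ fun P hP hIP => ?_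
  obtain ⟨Q, hQ, hQP⟩ := Ideal.exists_minimalPrimes_le (I := (⊥ : Ideal (ReesModAlg R E)))
    (J := P) bot_le
  have hQp : Q.IsPrime := hQ.1.1
  obtain ⟨Q1, hQ1, hQ1Q⟩ := Ideal.exists_comap_eq_of_mem_minimalPrimes_of_injective
    (f := (auxPsi R E φ).toRingHom) (auxPsi_injective R E φ) Q hQ
  obtain ⟨Q', hQ', hQ'1⟩ := Ideal.exists_minimalPrimes_le
    (I := (⊥ : Ideal (MvPolynomial (Fin e) (TotalQuot R)))) (J := Q1) bot_le
  have hQ'p : Q'.IsPrime := hQ'.1.1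
  have hQeq : Q = Q'.comap (auxPsi R E φ).toRingHom := by
    have hle : Q'.comap (auxPsi R E φ).toRingHom ≤ Q := hQ1Q ▸ Ideal.comap_mono hQ'1
    exact le_antisymm (hQ.2 ⟨inferInstance, bot_le⟩ hle) hle
  let p := Q'.under R
  have hQlies : Q.LiesOver p := ⟨by
    rw [hQeq]
    ext r
    simp [p, Ideal.under, Ideal.mem_comap]⟩
  have hpm : p ≠ IsLocalRing.maximalIdeal R := by
    intro hpm
    have hflat : Module.Flat R (MvPolynomial (Fin e) (TotalQuot R)) := by
      have : Module.Flat R (TotalQuot R) := IsLocalization.flat _ (nonZeroDivisors R)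
      exact Module.Flat.trans R (TotalQuot R) _
    have hmh : (IsLocalRing.maximalIdeal R).height = d := by
      have := IsLocalRing.maximalIdeal_height_eq_ringKrullDim (R := R)
      rw [hd] at this
      exact_mod_cast this
    obtain ⟨q, hq, hqle⟩ := Ideal.exists_minimalPrimes_le (I := (⊥ : Ideal R))
      (J := p) bot_le
    have hqp : q.IsPrime := hq.1.1
    have hqlt : q < p := by
      refine lt_of_le_of_ne hqle fun h => ?_
      have : q.height = 0 := by
        exact Ideal.height_eq_zero_iff.2 hq
      rw [h, hpm, hmh] at this
      have : d = 0 := by exact_mod_cast this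
      omega
    obtain ⟨Q0, hQ0lt, hQ0p, _⟩ := Ideal.exists_ideal_lt_liesOver_of_lt Q' (p := q) (q := p) hqlt
    exact hQ0lt.not_ge (hQ'.2 ⟨hQ0p, bot_le⟩ hQ0lt.le)
  have hQltP : Q < P := by
    refine lt_of_le_of_ne hQP fun h => hpm ?_
    have h1 : IsLocalRing.maximalIdeal R ≤ p := by
      rw [hQlies.over, h]
      exact Ideal.map_le_iff_le_comap.1 hIP
    exact ((IsLocalRing.maximalIdeal.isMaximal R).eq_of_le (Ideal.IsPrime.ne_top inferInstance) h1).symm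
  have hdim : ringKrullDim (ReesModAlg R E ⧸ Q) ≤ ((d + e : ℕ) : WithBot ℕ∞) := by
    rw [Nat.cast_add, ← hd]
    exact aux_dim_quot (auxPsi R E φ) Q' Q hQeq e (aux_trdeg R Q')
  have hfin := (aux_quot_lt Q P hQltP).trans hdim
  have h5 : d + e = (d + e - 1) + 1 := by omega
  rw [h5, Nat.cast_succ] at hfin
  exact ENat.WithBot.add_le_add_one_right_iff.1 hfin

end Bounds

/-- Bounds for the analytic spread: `e ≤ ℓ(E) ≤ d + e - 1`. -/
theorem statement_2 (R : Type u) [CommRing R] [IsLocalRing R] [IsNoetherianRing R]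
    [Infinite (IsLocalRing.ResidueField R)]
    (E : Type u) [AddCommGroup E] [Module R E] [Module.Finite R E]
    (d e : ℕ) (hd : ringKrullDim R = (d : WithBot ℕ∞)) (hd0 : 0 < d)
    (he : 0 < e) (hrank : HasRank R E e) :
    (e : WithBot ℕ∞) ≤ analyticSpread R E ∧
      analyticSpread R E ≤ ((d + e - 1 : ℕ) : WithBot ℕ∞) := by
  obtain ⟨φ⟩ := hrank
  exact ⟨aux_lower R E d e hd φ, aux_upper R E d e hd hd0 φ⟩
end
end
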